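/- arXiv:1804.09628 — 2 statements merged into one kernel-verified Lean document; each statement's English description precedes it below -/
import Mathlib

section
/- Let q be a prime power, K a finite field with q elements, K̄ an algebraic closure of K, and φ the Frobenius map on P¹(K̄) given by [a : b] ↦ [a^q : b^q]. The number of orbits of the componentwise action of PGL₂(K) on the set of ordered 6-tuples (x₁, …, x₆) of pairwise distinct points of P¹(K̄) satisfying φ(x₁) = x₂, φ(x₂) = x₃, φ(x₃) = x₁, φ(x₄) = x₅, φ(x₅) = x₆ and φ(x₆) = x₄ equals q³ − q − 3. -/
open Projectivization

/-! ## The projective line and the actions of `GL₂` and `PGL₂` -/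

/-- `GL₂(L)` as a group of linear automorphisms of `L²`. -/
noncomputable def glMulEquiv (L : Type*) [Field L] :
    GL (Fin 2) L ≃* ((Fin 2 → L) ≃ₗ[L] (Fin 2 → L)) :=
  (Matrix.GeneralLinearGroup.toLin).trans
    (LinearMap.GeneralLinearGroup.generalLinearEquiv L (Fin 2 → L))

theorem glMulEquiv_apply (L : Type*) [Field L] (g : GL (Fin 2) L) (v : Fin 2 → L) :
    glMulEquiv L g v = (g : Matrix (Fin 2) (Fin 2) L).mulVec v := by
  simp [glMulEquiv]

/-- The action of `GL₂(L)` on the projective line `P¹(L)`, given in homogeneous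
coordinates by `[a : b] ↦ [α a + β b : γ a + δ b]`. -/
noncomputable def glP1 (L : Type*) [Field L] :
    GL (Fin 2) L →* Function.End (Projectivization L (Fin 2 → L)) where
  toFun g := Projectivization.map (glMulEquiv L g).toLinearMap (glMulEquiv L g).injective
  map_one' := by
    funext x
    induction x using Projectivization.ind with
    | h v hv =>
      show Projectivization.map (glMulEquiv L 1).toLinearMap (glMulEquiv L 1).injective
          (Projectivization.mk L v hv) = Projectivization.mk L v hv
      rw [Projectivization.map_mk, Projectivization.mk_eq_mk_iff']
      exact ⟨1, by simp [glMulEquiv_apply]⟩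
  map_mul' g h := by
    funext x
    induction x using Projectivization.ind with
    | h v hv =>
      show Projectivization.map (glMulEquiv L (g * h)).toLinearMap
          (glMulEquiv L (g * h)).injective (Projectivization.mk L v hv)
        = Projectivization.map (glMulEquiv L g).toLinearMap (glMulEquiv L g).injective
            (Projectivization.map (glMulEquiv L h).toLinearMap (glMulEquiv L h).injective
              (Projectivization.mk L v hv))
      rw [Projectivization.map_mk, Projectivization.map_mk, Projectivization.map_mk,
        Projectivization.mk_eq_mk_iff']
      exact ⟨1, by simp [glMulEquiv_apply, Matrix.mulVec_mulVec]⟩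

/-- The action of `GL₂(L)` on `P¹(L)` as a `MulAction`. -/
noncomputable instance glP1Action (L : Type*) [Field L] :
    MulAction (GL (Fin 2) L) (Projectivization L (Fin 2 → L)) :=
  MulAction.ofEndHom (glP1 L)

/-- The subgroup of scalar matrices inside `GL₂(L)`. -/
def scalarSubgroup (L : Type*) [Field L] : Subgroup (GL (Fin 2) L) :=
  (Units.map ((Matrix.scalar (Fin 2)) : L →+* Matrix (Fin 2) (Fin 2) L).toMonoidHom).range

instance scalarSubgroup_normal (L : Type*) [Field L] : (scalarSubgroup L).Normal := by
  constructor
  rintro n ⟨a, rfl⟩ g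
  refine ⟨a, ?_⟩
  have hc : Commute (Units.map ((Matrix.scalar (Fin 2)) :
      L →+* Matrix (Fin 2) (Fin 2) L).toMonoidHom a) g := by
    apply Units.ext
    simpa using (Matrix.scalar_commute (a : L) (fun r => mul_comm _ _)
      (g : Matrix (Fin 2) (Fin 2) L)).eq
  rw [← hc.eq, mul_assoc, mul_inv_cancel, mul_one]

/-- `PGL₂(K)`: the quotient of `GL₂(K)` by the subgroup of scalar matrices. -/
abbrev PGL2 (K : Type*) [Field K] := GL (Fin 2) K ⧸ scalarSubgroup K

/-- Scalar matrices act trivially on the projective line. -/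
theorem glP1_scalar_eq_one (L : Type*) [Field L] (a : Lˣ) :
    glP1 L (Units.map ((Matrix.scalar (Fin 2)) :
      L →+* Matrix (Fin 2) (Fin 2) L).toMonoidHom a) = 1 := by
  set u := Units.map ((Matrix.scalar (Fin 2)) :
      L →+* Matrix (Fin 2) (Fin 2) L).toMonoidHom a with hu
  funext x
  induction x using Projectivization.ind with
  | h v hv =>
    show Projectivization.map (glMulEquiv L u).toLinearMap (glMulEquiv L u).injective
        (Projectivization.mk L v hv) = Projectivization.mk L v hv
    rw [Projectivization.map_mk, Projectivization.mk_eq_mk_iff']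
    refine ⟨(a : L), ?_⟩
    simp [glMulEquiv_apply, hu, Matrix.scalar_apply, Matrix.diagonal_const_mulVec]

/-- For a field homomorphism `f : K →+* L`, the scalar matrices of `GL₂(K)` act trivially on
`P¹(L)`, hence the action of `GL₂(K)` on `P¹(L)` descends to an action of `PGL₂(K)`. -/
noncomputable def pglP1 {K L : Type*} [Field K] [Field L] (f : K →+* L) :
    PGL2 K →* Function.End (Projectivization L (Fin 2 → L)) :=
  QuotientGroup.lift (scalarSubgroup K)
    ((glP1 L).comp (Matrix.GeneralLinearGroup.map f))
    (by
      rintro z ⟨a, rfl⟩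
      have key : Matrix.GeneralLinearGroup.map (n := Fin 2) f
          (Units.map ((Matrix.scalar (Fin 2)) : K →+* Matrix (Fin 2) (Fin 2) K).toMonoidHom a)
          = Units.map ((Matrix.scalar (Fin 2)) :
              L →+* Matrix (Fin 2) (Fin 2) L).toMonoidHom (Units.map f.toMonoidHom a) := by
        apply Units.ext
        ext i j
        simp [Matrix.GeneralLinearGroup.map, Matrix.scalar_apply, Matrix.diagonal,
          Matrix.map_apply, apply_ite f]
      rw [MonoidHom.mem_ker, MonoidHom.comp_apply, key, glP1_scalar_eq_one])

/-- The action of `PGL₂(K)` on `P¹(L)`, for any extension `L` of `K` via `f : K →+* L`. -/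
noncomputable def pglP1Action {K L : Type*} [Field K] [Field L] (f : K →+* L) :
    MulAction (PGL2 K) (Projectivization L (Fin 2 → L)) :=
  MulAction.ofEndHom (pglP1 f)
/-- The Frobenius map on the projective line `P¹(L)`, acting in homogeneous coordinates by
`[a : b] ↦ [a ^ q : b ^ q]`. -/
noncomputable def frobP1 {L : Type*} [Field L] (q : ℕ)
    (x : Projectivization L (Fin 2 → L)) : Projectivization L (Fin 2 → L) :=
  Projectivization.mk L (fun i => (x.rep i) ^ q) (by
    intro hzero
    obtain ⟨i, hi⟩ := Function.ne_iff.mp x.rep_nonzero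
    have h2 : x.rep i ^ q = 0 := congrFun hzero i
    exact hi (by simpa using (pow_eq_zero_iff'.mp h2).1))

noncomputable instance pglP1ClosureAction (K : Type*) [Field K] :
    MulAction (PGL2 K)
      (Projectivization (AlgebraicClosure K) (Fin 2 → AlgebraicClosure K)) :=
  pglP1Action (algebraMap K (AlgebraicClosure K))

open Polynomial in
theorem ncard_pow_card_pow_eq_self (K : Type*) [Field K] [Fintype K] (n : ℕ) (hn : n ≠ 0) :
    {a : AlgebraicClosure K | a ^ (Fintype.card K ^ n) = a}.ncard = Fintype.card K ^ n := by
  obtain ⟨p, hp⟩ := CharP.exists K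
  have : CharP (AlgebraicClosure K) p := charP_of_injective_algebraMap' K p
  have hdvd : p ∣ Fintype.card K ^ n :=
    dvd_pow ((CharP.cast_eq_zero_iff K p _).mp (FiniteField.cast_card_eq_zero K)) hn
  have h1 : 1 < Fintype.card K ^ n := Nat.one_lt_pow hn Fintype.one_lt_card
  have hsep := galois_poly_separable (K := AlgebraicClosure K) p _ hdvd
  have hcard := card_rootSet_eq_natDegree (K := AlgebraicClosure K) hsep (IsAlgClosed.splits _)
  rw [FiniteField.X_pow_card_sub_X_natDegree_eq _ h1, ← Nat.card_eq_fintype_card,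
    Nat.card_coe_set_eq] at hcard
  refine Eq.trans (congrArg Set.ncard ?_) hcard
  ext a
  rw [mem_rootSet_of_ne (FiniteField.X_pow_card_sub_X_ne_zero _ h1)]
  simp [sub_eq_zero]

section ProjectiveLine

variable {K : Type*} [Field K]

/-- The point `[a : 1]` of the projective line. -/
def affinePoint (a : K) : Projectivization K (Fin 2 → K) :=
  Projectivization.mk K ![a, 1] fun h => one_ne_zero (congrFun h 1)

theorem affinePoint_injective : Function.Injective (affinePoint (K := K)) := by
  intro a b h
  obtain ⟨c, hc⟩ := (Projectivization.mk_eq_mk_iff' _ _ _ _ _).mp h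
  have h0 := congrFun hc 0
  have h1 := congrFun hc 1
  simp at h0 h1
  simpa [h1] using h0.symm

theorem frobP1_mk {q : ℕ} (v w : Fin 2 → K) (hv : v ≠ 0) (hw : w ≠ 0)
    (h : ∀ i, w i = v i ^ q) :
    frobP1 q (Projectivization.mk K v hv) = Projectivization.mk K w hw := by
  obtain ⟨c, hc⟩ := Projectivization.exists_smul_eq_mk_rep K v hv
  rw [frobP1, Projectivization.mk_eq_mk_iff']
  refine ⟨(c : K) ^ q, ?_⟩
  funext i
  rw [← hc]
  simp [h, Units.smul_def, mul_pow]

theorem frobP1_affinePoint (q : ℕ) (a : K) :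
    frobP1 q (affinePoint a) = affinePoint (a ^ q) := by
  apply frobP1_mk
  intro i
  fin_cases i <;> simp

theorem exists_eq_affinePoint {q : ℕ} (hq : q ≠ 0) {x : Projectivization K (Fin 2 → K)}
    (hx : frobP1 q x ≠ x) : ∃ a, x = affinePoint a := by
  induction x using Projectivization.ind with
  | h v hv =>
    by_cases h1 : v 1 = 0
    · have h0 : v 0 ≠ 0 := fun h0 => hv (by funext i; fin_cases i <;> simp [h0, h1])
      have hv' : (fun i => v i ^ q) ≠ 0 := fun h => pow_ne_zero q h0 (congrFun h 0)
      refine (hx ?_).elim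
      rw [frobP1_mk v _ hv hv' fun _ => rfl, Projectivization.mk_eq_mk_iff']
      refine ⟨v 0 ^ q / v 0, ?_⟩
      funext i
      fin_cases i
      · simp [h0]
      · simp [h1, hq]
    · refine ⟨v 0 / v 1, ?_⟩
      rw [affinePoint, Projectivization.mk_eq_mk_iff']
      refine ⟨v 1, ?_⟩
      funext i
      fin_cases i
      · simp [mul_div_cancel₀ _ h1]
      · simp

local notation "Kbar" => AlgebraicClosure K

theorem pgl_smul_mk (g : GL (Fin 2) K) (v : Fin 2 → Kbar) (hv : v ≠ 0) :
    ∃ hw, (QuotientGroup.mk g : PGL2 K) • Projectivization.mk Kbar v hv =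
      Projectivization.mk Kbar
        ![algebraMap K Kbar (g 0 0) * v 0 + algebraMap K Kbar (g 0 1) * v 1,
          algebraMap K Kbar (g 1 0) * v 0 + algebraMap K Kbar (g 1 1) * v 1] hw := by
  have hmul : glMulEquiv Kbar (Matrix.GeneralLinearGroup.map (algebraMap K Kbar) g) v =
      ![algebraMap K Kbar (g 0 0) * v 0 + algebraMap K Kbar (g 0 1) * v 1,
        algebraMap K Kbar (g 1 0) * v 0 + algebraMap K Kbar (g 1 1) * v 1] := by
    rw [glMulEquiv_apply]
    funext i
    fin_cases i <;> simp [Matrix.mulVec, dotProduct, Fin.sum_univ_two]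
  rw [← hmul]
  exact ⟨(LinearEquiv.map_ne_zero_iff _).mpr hv, rfl⟩

theorem smul_affinePoint_eq_iff (g : GL (Fin 2) K) (a b : Kbar) :
    (QuotientGroup.mk g : PGL2 K) • affinePoint a = affinePoint b ↔
      algebraMap K Kbar (g 0 0) * a + algebraMap K Kbar (g 0 1) =
        (algebraMap K Kbar (g 1 0) * a + algebraMap K Kbar (g 1 1)) * b := by
  obtain ⟨h, e⟩ := pgl_smul_mk g ![a, 1] fun h => one_ne_zero (congrFun h 1)
  rw [affinePoint, e, affinePoint, Projectivization.mk_eq_mk_iff']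
  constructor
  · rintro ⟨c, hc⟩
    have h0 := congrFun hc 0
    have h1 := congrFun hc 1
    simp at h0 h1
    rw [← h0, ← h1]
  · intro hab
    refine ⟨algebraMap K Kbar (g 1 0) * a + algebraMap K Kbar (g 1 1), ?_⟩
    funext i
    fin_cases i <;> simp [hab]

variable [Fintype K]

theorem frobP1_smul (g : PGL2 K) (x : Projectivization Kbar (Fin 2 → Kbar)) :
    frobP1 (Fintype.card K) (g • x) = g • frobP1 (Fintype.card K) x := by
  induction g using QuotientGroup.induction_on with
  | H g =>
    induction x using Projectivization.ind with
    | h v hv =>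
      have hv' : (fun i => v i ^ Fintype.card K) ≠ 0 := by
        contrapose! hv
        funext i
        exact eq_zero_of_pow_eq_zero (congrFun hv i)
      obtain ⟨h1, e1⟩ := pgl_smul_mk g v hv
      obtain ⟨h2, e2⟩ := pgl_smul_mk g _ hv'
      rw [e1, frobP1_mk v _ hv hv' fun _ => rfl, e2]
      apply frobP1_mk
      have key (a b : K) (x y : Kbar) :
          algebraMap K Kbar a * x ^ Fintype.card K + algebraMap K Kbar b * y ^ Fintype.card K =
            (algebraMap K Kbar a * x + algebraMap K Kbar b * y) ^ Fintype.card K := by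
        have h := map_add (FiniteField.frobeniusAlgHom K Kbar) (algebraMap K Kbar a * x)
          (algebraMap K Kbar b * y)
        rw [map_mul, map_mul, AlgHom.commutes, AlgHom.commutes] at h
        exact h.symm
      intro i
      fin_cases i <;> simp [key]

variable (K) in
/-- The elements of the algebraic closure of `K` of degree `3` over the finite field `K`. -/
def cubicElements : Set Kbar :=
  {a | a ^ (Fintype.card K ^ 3) = a} \ {a | a ^ Fintype.card K = a}

theorem mem_cubicElements_iff {a : Kbar} :
    a ∈ cubicElements K ↔
      ((a ^ Fintype.card K) ^ Fintype.card K) ^ Fintype.card K = a ∧ a ^ Fintype.card K ≠ a := by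
  simp only [cubicElements, Set.mem_sdiff, Set.mem_ofPred_eq, ← pow_mul]
  rw [pow_succ, pow_two]

theorem pow_card_injective : Function.Injective fun a : Kbar => a ^ Fintype.card K :=
  (FiniteField.frobeniusAlgHom K Kbar).injective

theorem cubicElements_pairwise_ne {a : Kbar} (ha : a ∈ cubicElements K) :
    a ^ Fintype.card K ≠ a ∧ (a ^ Fintype.card K) ^ Fintype.card K ≠ a ∧
      (a ^ Fintype.card K) ^ Fintype.card K ≠ a ^ Fintype.card K := by
  rw [mem_cubicElements_iff] at ha
  obtain ⟨h3, h1⟩ := ha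
  refine ⟨h1, fun h => h1 ?_, fun h => h1 (pow_card_injective h)⟩
  rwa [h] at h3

theorem ncard_cubicElements :
    (cubicElements K).ncard = Fintype.card K ^ 3 - Fintype.card K := by
  have h1 := ncard_pow_card_pow_eq_self K 1 one_ne_zero
  rw [pow_one] at h1
  have hfin : {a : Kbar | a ^ Fintype.card K = a}.Finite :=
    Set.finite_of_ncard_ne_zero (by rw [h1]; exact Fintype.card_ne_zero)
  have hsub : {a : Kbar | a ^ Fintype.card K = a} ⊆ {a | a ^ (Fintype.card K ^ 3) = a} := by
    intro a (ha : a ^ Fintype.card K = a)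
    simp [pow_succ, pow_mul, ha]
  rw [cubicElements, Set.ncard_sdiff hsub hfin, ncard_pow_card_pow_eq_self K 3 (by norm_num), h1]

theorem quadratic_coeffs_eq_zero {a : Kbar} (ha : a ∈ cubicElements K) {r s t : K}
    (h : algebraMap K Kbar r * a ^ 2 + algebraMap K Kbar s * a + algebraMap K Kbar t = 0) :
    r = 0 ∧ s = 0 ∧ t = 0 := by
  obtain ⟨n1, n2, n3⟩ := cubicElements_pairwise_ne ha
  have step {x : Kbar}
      (hx : algebraMap K Kbar r * x ^ 2 + algebraMap K Kbar s * x + algebraMap K Kbar t = 0) :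
      algebraMap K Kbar r * (x ^ Fintype.card K) ^ 2 + algebraMap K Kbar s * x ^ Fintype.card K +
        algebraMap K Kbar t = 0 := by
    have h := congrArg (FiniteField.frobeniusAlgHom K Kbar) hx
    simp only [map_add, map_mul, map_pow, AlgHom.commutes, map_zero] at h
    exact h
  have h' := step h
  have h'' := step h'
  generalize (a ^ Fintype.card K) ^ Fintype.card K = c at *
  generalize a ^ Fintype.card K = b at *
  have e1 : algebraMap K Kbar r * (b + a) + algebraMap K Kbar s = 0 :=
    mul_left_cancel₀ (sub_ne_zero.mpr n1) (by linear_combination h' - h)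
  have e2 : algebraMap K Kbar r * (c + a) + algebraMap K Kbar s = 0 :=
    mul_left_cancel₀ (sub_ne_zero.mpr n2) (by linear_combination h'' - h)
  have hr : algebraMap K Kbar r = 0 :=
    mul_left_cancel₀ (sub_ne_zero.mpr n3) (by linear_combination e2 - e1)
  have hs : algebraMap K Kbar s = 0 := by simpa [hr] using e1
  have ht : algebraMap K Kbar t = 0 := by simpa [hr, hs] using h
  simpa using And.intro hr (And.intro hs ht)

/-- `PGL₂(K)` acts freely on the cubic points. -/
theorem eq_one_of_smul_affinePoint_eq {a : Kbar} (ha : a ∈ cubicElements K) {g : PGL2 K}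
    (h : g • affinePoint a = affinePoint a) : g = 1 := by
  induction g using QuotientGroup.induction_on with
  | H g =>
    rw [smul_affinePoint_eq_iff] at h
    obtain ⟨h10, hd, h01⟩ := quadratic_coeffs_eq_zero ha
      (r := g 1 0) (s := g 1 1 - g 0 0) (t := - g 0 1) (by
        rw [map_sub, map_neg]; linear_combination -h)
    have h01 : g 0 1 = 0 := neg_eq_zero.mp h01
    have hd : g 1 1 = g 0 0 := sub_eq_zero.mp hd
    have hdet : (g : Matrix (Fin 2) (Fin 2) K).det ≠ 0 :=
      ((Matrix.isUnit_iff_isUnit_det _).mp g.isUnit).ne_zero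
    have h00 : g 0 0 ≠ 0 := by
      intro h00
      exact hdet (by rw [Matrix.det_fin_two, h00, h01]; ring)
    rw [QuotientGroup.eq_one_iff]
    refine ⟨Units.mk0 (g 0 0) h00, Units.ext ?_⟩
    ext i j
    fin_cases i <;> fin_cases j <;> simp [h10, h01, hd]

theorem not_mem_range_of_mem_cubicElements {a : Kbar} (ha : a ∈ cubicElements K) (r : K) :
    algebraMap K Kbar r ≠ a := by
  rintro rfl
  refine ha.2 ?_
  simp [← map_pow, FiniteField.pow_card]

/-- `PGL₂(K)` acts transitively on the cubic points. -/
theorem exists_smul_affinePoint_eq {a b : Kbar} (ha : a ∈ cubicElements K)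
    (hb : b ∈ cubicElements K) : ∃ g : PGL2 K, g • affinePoint a = affinePoint b := by
  obtain ⟨u, hu, hu0⟩ : ∃ u : Fin 4 → K,
      algebraMap K Kbar (u 0) * a + algebraMap K Kbar (u 1) =
        (algebraMap K Kbar (u 2) * a + algebraMap K Kbar (u 3)) * b ∧ u ≠ 0 := by
    let f : (Fin 4 → K) → Kbar := fun u =>
      algebraMap K Kbar (u 0) * a + algebraMap K Kbar (u 1) -
        (algebraMap K Kbar (u 2) * a + algebraMap K Kbar (u 3)) * b
    have hmaps : ∀ u ∈ (Set.univ : Set (Fin 4 → K)),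
        f u ∈ {x : Kbar | x ^ (Fintype.card K ^ 3) = x} := by
      intro u _
      have ha' := ha.1
      have hb' := hb.1
      have hF (x : Kbar) : x ^ (Fintype.card K ^ 3) =
          FiniteField.frobeniusAlgHom K Kbar (FiniteField.frobeniusAlgHom K Kbar
            (FiniteField.frobeniusAlgHom K Kbar x)) := by
        simp only [FiniteField.frobeniusAlgHom_apply, ← pow_mul]
        rw [pow_succ, pow_two]
      rw [Set.mem_ofPred_eq, hF] at ha' hb' ⊢
      simp only [f, map_sub, map_add, map_mul, ha', hb', AlgHom.commutes]
    have hcard : {x : Kbar | x ^ (Fintype.card K ^ 3) = x}.ncard <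
        (Set.univ : Set (Fin 4 → K)).ncard := by
      rw [ncard_pow_card_pow_eq_self K 3 (by norm_num), Set.ncard_univ, Nat.card_eq_fintype_card,
        Fintype.card_fun, Fintype.card_fin]
      exact Nat.pow_lt_pow_right Fintype.one_lt_card (by norm_num)
    have hfin : {x : Kbar | x ^ (Fintype.card K ^ 3) = x}.Finite := by
      refine Set.finite_of_ncard_ne_zero ?_
      rw [ncard_pow_card_pow_eq_self K 3 (by norm_num)]
      exact pow_ne_zero _ Fintype.card_ne_zero
    obtain ⟨u, -, v, -, huv, hfuv⟩ :=
      Set.exists_ne_map_eq_of_ncard_lt_of_maps_to hcard hmaps hfin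
    refine ⟨u - v, ?_, sub_ne_zero.mpr huv⟩
    simp only [f] at hfuv
    simp only [Pi.sub_apply, map_sub]
    linear_combination hfuv
  have hdet : (!![u 0, u 1; u 2, u 3] : Matrix (Fin 2) (Fin 2) K).det ≠ 0 := by
    intro hdet
    rw [Matrix.det_fin_two_of, sub_eq_zero] at hdet
    have hd := congrArg (algebraMap K Kbar) hdet
    rw [map_mul, map_mul] at hd
    by_cases h2 : u 2 = 0
    · by_cases h3 : u 3 = 0
      · have h := quadratic_coeffs_eq_zero ha (r := 0) (s := u 0) (t := u 1) (by
          simpa [h2, h3] using hu)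
        refine hu0 (funext fun i => ?_)
        fin_cases i
        exacts [h.2.1, h.2.2, h2, h3]
      · refine not_mem_range_of_mem_cubicElements hb (u 1 / u 3) ?_
        have h0 : u 0 = 0 := by simpa [h2, h3] using hdet
        have h3' : algebraMap K Kbar (u 3) ≠ 0 := by simpa using h3
        rw [map_div₀, div_eq_iff h3']
        simpa [h0, h2, mul_comm] using hu
    · refine not_mem_range_of_mem_cubicElements hb (u 0 / u 2) ?_
      have h2' : algebraMap K Kbar (u 2) ≠ 0 := by simpa using h2
      have hne : algebraMap K Kbar (u 2) * a + algebraMap K Kbar (u 3) ≠ 0 := fun h =>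
        h2 (quadratic_coeffs_eq_zero ha (r := 0) (s := u 2) (t := u 3) (by simpa using h)).2.1
      rw [map_div₀, div_eq_iff h2']
      refine mul_left_cancel₀ hne ?_
      linear_combination algebraMap K Kbar (u 2) * hu + hd
  refine ⟨QuotientGroup.mk (Matrix.GeneralLinearGroup.mkOfDetNeZero _ hdet), ?_⟩
  rw [smul_affinePoint_eq_iff]
  simpa [Matrix.GeneralLinearGroup.mkOfDetNeZero] using hu

/-- The six points formed by the Frobenius orbits of `[a : 1]` and `[b : 1]`. -/
noncomputable def frobeniusTuple (a b : Kbar) : Fin 6 → Projectivization Kbar (Fin 2 → Kbar) :=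
  ![affinePoint a, affinePoint (a ^ Fintype.card K),
    affinePoint ((a ^ Fintype.card K) ^ Fintype.card K),
    affinePoint b, affinePoint (b ^ Fintype.card K),
    affinePoint ((b ^ Fintype.card K) ^ Fintype.card K)]

variable (K) in
/-- Tuples of six distinct points forming two Frobenius cycles of length three. -/
abbrev FrobeniusCyclePair :=
  {x : Fin 6 → Projectivization Kbar (Fin 2 → Kbar) //
    Function.Injective x ∧
    frobP1 (Fintype.card K) (x 0) = x 1 ∧
    frobP1 (Fintype.card K) (x 1) = x 2 ∧
    frobP1 (Fintype.card K) (x 2) = x 0 ∧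
    frobP1 (Fintype.card K) (x 3) = x 4 ∧
    frobP1 (Fintype.card K) (x 4) = x 5 ∧
    frobP1 (Fintype.card K) (x 5) = x 3}

/-- The cubic elements that are not Frobenius conjugates of `a`. -/
def nonConjugates (a : Kbar) : Set Kbar :=
  cubicElements K \ {a, a ^ Fintype.card K, (a ^ Fintype.card K) ^ Fintype.card K}

theorem ncard_nonConjugates {a : Kbar} (ha : a ∈ cubicElements K) :
    (nonConjugates a).ncard = Fintype.card K ^ 3 - Fintype.card K - 3 := by
  obtain ⟨n1, n2, n3⟩ := cubicElements_pairwise_ne ha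
  have h3 := (mem_cubicElements_iff.mp ha).1
  rw [nonConjugates, Set.ncard_sdiff, ncard_cubicElements, Set.ncard_eq_three.mpr
    ⟨_, _, _, n1.symm, n2.symm, n3.symm, rfl⟩]
  · rintro x (rfl | rfl | rfl)
    · exact ha
    · exact mem_cubicElements_iff.mpr ⟨by rw [h3], n3⟩
    · exact mem_cubicElements_iff.mpr ⟨by rw [h3], by rw [h3]; exact n2.symm⟩

theorem injective_frobeniusTuple {a b : Kbar} (ha : a ∈ cubicElements K)
    (hb : b ∈ nonConjugates a) : Function.Injective (frobeniusTuple a b) := by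
  obtain ⟨a1, a2, a3⟩ := cubicElements_pairwise_ne ha
  obtain ⟨b1, b2, b3⟩ := cubicElements_pairwise_ne hb.1
  have ha3 := (mem_cubicElements_iff.mp ha).1
  have hb3 := (mem_cubicElements_iff.mp hb.1).1
  have hb' := hb.2
  simp only [Set.mem_insert_iff, Set.mem_singleton_iff, not_or] at hb'
  obtain ⟨c1, c2, c3⟩ := hb'
  have e : frobeniusTuple a b = affinePoint ∘
      ![a, a ^ Fintype.card K, (a ^ Fintype.card K) ^ Fintype.card K,
        b, b ^ Fintype.card K, (b ^ Fintype.card K) ^ Fintype.card K] := by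
    funext i
    fin_cases i <;> rfl
  rw [e]
  refine affinePoint_injective.comp ?_
  generalize Fintype.card K = q at *
  intro i j hij
  fin_cases i <;> fin_cases j <;> simp at hij ⊢ <;> grind

theorem eq_frobeniusTuple (x : FrobeniusCyclePair K) :
    ∃ a ∈ cubicElements K, ∃ b ∈ nonConjugates a, x.1 = frobeniusTuple a b := by
  obtain ⟨x, hx, h0, h1, h2, h3, h4, h5⟩ := x
  have cubic {i j k : Fin 6} (hij : i ≠ j) (hi : frobP1 (Fintype.card K) (x i) = x j)
      (hj : frobP1 (Fintype.card K) (x j) = x k) (hk : frobP1 (Fintype.card K) (x k) = x i) :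
      ∃ a ∈ cubicElements K, x i = affinePoint a ∧ x j = affinePoint (a ^ Fintype.card K) ∧
        x k = affinePoint ((a ^ Fintype.card K) ^ Fintype.card K) := by
    have hne : frobP1 (Fintype.card K) (x i) ≠ x i := by
      rw [hi]
      exact fun h => hij (hx h).symm
    obtain ⟨a, ha⟩ := exists_eq_affinePoint Fintype.card_ne_zero hne
    rw [ha, frobP1_affinePoint] at hi hne
    rw [← hi, frobP1_affinePoint] at hj
    rw [← hj, frobP1_affinePoint, ha] at hk
    exact ⟨a, mem_cubicElements_iff.mpr ⟨affinePoint_injective hk, fun h => hne (by rw [h])⟩,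
      ha, hi.symm, hj.symm⟩
  obtain ⟨a, ha, a0, a1, a2⟩ := cubic (by decide) h0 h1 h2
  obtain ⟨b, hb, b0, b1, b2⟩ := cubic (by decide) h3 h4 h5
  refine ⟨a, ha, b, ⟨hb, ?_⟩, ?_⟩
  · rintro (h | h | h)
    · exact absurd (hx (b0.trans (h ▸ a0.symm))) (by decide)
    · exact absurd (hx (b0.trans (h ▸ a1.symm))) (by decide)
    · exact absurd (hx (b0.trans (h ▸ a2.symm))) (by decide)
  · funext i
    fin_cases i
    exacts [a0, a1, a2, b0, b1, b2]

/-- The pair of Frobenius cycles through `[a : 1]` and `[b : 1]`. -/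
noncomputable def frobeniusCyclePair {a b : Kbar} (ha : a ∈ cubicElements K)
    (hb : b ∈ nonConjugates a) : FrobeniusCyclePair K :=
  ⟨frobeniusTuple a b, injective_frobeniusTuple ha hb, frobP1_affinePoint _ _,
    frobP1_affinePoint _ _,
    (frobP1_affinePoint _ _).trans (congrArg _ (mem_cubicElements_iff.mp ha).1),
    frobP1_affinePoint _ _, frobP1_affinePoint _ _,
    (frobP1_affinePoint _ _).trans (congrArg _ (mem_cubicElements_iff.mp hb.1).1)⟩

/-- `PGL₂(K)` preserves pairs of Frobenius cycles. -/
noncomputable def smulFrobeniusCyclePair (g : PGL2 K) (x : FrobeniusCyclePair K) :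
    FrobeniusCyclePair K :=
  ⟨g • x.1, (MulAction.injective g).comp x.2.1, by
    obtain ⟨-, h0, h1, h2, h3, h4, h5⟩ := x.2
    simp only [Pi.smul_apply, frobP1_smul, h0, h1, h2, h3, h4, h5, and_self]⟩

variable (K) in
/-- Pairs of Frobenius cycles up to the action of `PGL₂(K)`. -/
noncomputable abbrev frobeniusCyclePairSetoid : Setoid (FrobeniusCyclePair K) :=
  Setoid.comap Subtype.val
    (MulAction.orbitRel (PGL2 K) (Fin 6 → Projectivization Kbar (Fin 2 → Kbar)))

theorem bijective_mk_frobeniusCyclePair {a : Kbar} (ha : a ∈ cubicElements K) :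
    Function.Bijective fun b : nonConjugates a =>
      (Quotient.mk (frobeniusCyclePairSetoid K) (frobeniusCyclePair ha b.2)) := by
  constructor
  · intro b c h
    obtain ⟨g, hg⟩ := Quotient.exact h
    have hg1 : g = 1 := eq_one_of_smul_affinePoint_eq ha (congrFun hg 0)
    rw [hg1] at hg
    have hbc : affinePoint (c : Kbar) = affinePoint (b : Kbar) :=
      (one_smul (PGL2 K) _).symm.trans (congrFun hg 3)
    exact Subtype.ext (affinePoint_injective hbc).symm
  · intro y
    induction y using Quotient.inductionOn with
    | h x =>
      obtain ⟨c, hc, d, -, hx⟩ := eq_frobeniusTuple x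
      obtain ⟨g, hg⟩ := exists_smul_affinePoint_eq hc ha
      obtain ⟨a', -, b, hb, hgx⟩ := eq_frobeniusTuple (smulFrobeniusCyclePair g x)
      have h0 : g • x.1 0 = affinePoint a' := congrFun hgx 0
      rw [hx] at h0
      obtain rfl : a = a' := affinePoint_injective (hg.symm.trans h0)
      exact ⟨⟨b, hb⟩, Quotient.sound ⟨g, hgx⟩⟩

end ProjectiveLine

/-- the number of `PGL₂(K)`-orbits of injective 6-tuples on `P¹(K̄)`
satisfying the stated Frobenius conditions. -/
theorem statement9 (q : ℕ) (hq : IsPrimePow q)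
    (K : Type*) [Field K] [Fintype K] (hK : Fintype.card K = q) :
    (Nat.card (Quotient (Setoid.comap
      (Subtype.val :
        {x : Fin 6 → Projectivization (AlgebraicClosure K) (Fin 2 → AlgebraicClosure K) //
          Function.Injective x ∧
          frobP1 q (x 0) = x 1 ∧
          frobP1 q (x 1) = x 2 ∧
          frobP1 q (x 2) = x 0 ∧
          frobP1 q (x 3) = x 4 ∧
          frobP1 q (x 4) = x 5 ∧
          frobP1 q (x 5) = x 3} →
        (Fin 6 → Projectivization (AlgebraicClosure K) (Fin 2 → AlgebraicClosure K)))
      (MulAction.orbitRel (PGL2 K)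
        (Fin 6 → Projectivization (AlgebraicClosure K) (Fin 2 → AlgebraicClosure K))))) : ℤ)
    = (q : ℤ) ^ 3 - (q : ℤ) - 3 := by
  subst hK
  have h2 : 2 ≤ Fintype.card K := Fintype.one_lt_card
  have h3 : Fintype.card K + 3 ≤ Fintype.card K ^ 3 := by nlinarith [Nat.mul_le_mul h2 h2]
  obtain ⟨a, ha⟩ : (cubicElements K).Nonempty :=
    Set.nonempty_of_ncard_ne_zero (by rw [ncard_cubicElements]; omega)
  have h := Nat.card_eq_of_bijective _ (bijective_mk_frobeniusCyclePair ha)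
  rw [Nat.card_coe_set_eq, ncard_nonConjugates ha] at h
  rw [← h]
  push_cast [Nat.sub_sub, Nat.cast_sub h3]
  ring
end

section
/- Let q be a prime power, K a finite field with q elements, K̄ an algebraic closure of K, and φ the Frobenius map on P¹(K̄) given by [a : b] ↦ [a^q : b^q]. The number of ordered 6-tuples (x₁, …, x₆) of pairwise distinct points of P¹(K̄) satisfying φ(x₁) = x₂, φ(x₂) = x₃, φ(x₃) = x₄, φ(x₄) = x₅, φ(x₅) = x₆ and φ(x₆) = x₁ equals q⁶ − q³ − q² + q. -/
open Projectivization

open Function Polynomial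

theorem iterate_apply_zero_of_cyclic {α : Type*} {f : α → α} {n : ℕ} [NeZero n] {x : Fin n → α}
    (hf : ∀ i, f (x i) = x (i + 1)) (k : ℕ) : f^[k] (x 0) = x (Fin.ofNat n k) := by
  induction k with
  | zero => simp
  | succ k ih =>
    rw [iterate_succ_apply', ih, hf]
    congr 1
    ext
    simp [Fin.val_add]

/-- An injective `n`-tuple whose entries are cyclically permuted by `f` is the orbit of its first
entry, which is an arbitrary point of minimal period `n`. -/
def cyclicTuplesEquiv {α : Type*} (f : α → α) (n : ℕ) [NeZero n] :
    {x : Fin n → α // Injective x ∧ ∀ i, f (x i) = x (i + 1)} ≃ {a // minimalPeriod f a = n} where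
  toFun x := ⟨x.1 0, by
    obtain ⟨x, hx, hf⟩ := x
    have hpow := iterate_apply_zero_of_cyclic hf
    have hper (k : ℕ) : IsPeriodicPt f k (x 0) ↔ n ∣ k := by
      rw [IsPeriodicPt, IsFixedPt, hpow, hx.eq_iff, Fin.ext_iff]
      simp [Nat.dvd_iff_mod_eq_zero]
    exact Nat.dvd_antisymm ((hper n).2 dvd_rfl).minimalPeriod_dvd
      ((hper _).1 (isPeriodicPt_minimalPeriod f _))⟩
  invFun a := ⟨fun i => f^[i] a.1, by
    intro i j hij
    exact Fin.ext (iterate_injOn_Iio_minimalPeriod (f := f) (x := a.1)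
      (by simp [a.2]) (by simp [a.2]) hij), by
    intro i
    have h := iterate_mod_minimalPeriod_eq (f := f) (x := a.1) (n := i + 1)
    rw [a.2] at h
    simp only [← iterate_succ_apply' f, ← h, Fin.val_add, Fin.val_one', Nat.add_mod_mod]⟩
  left_inv x := by
    ext i
    simp [iterate_apply_zero_of_cyclic x.2.2]
  right_inv a := by simp

theorem frobP1_mk_s14 {L : Type*} [Field L] (q : ℕ) (v : Fin 2 → L) (hv : v ≠ 0)
    (hv' : (fun i => v i ^ q) ≠ 0) :
    frobP1 q (Projectivization.mk L v hv) = Projectivization.mk L (fun i => v i ^ q) hv' := by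
  obtain ⟨a, ha⟩ := Projectivization.exists_smul_eq_mk_rep L v hv
  refine (Projectivization.mk_eq_mk_iff' L _ _ _ _).2 ⟨(a : L) ^ q, ?_⟩
  ext i
  simp [← ha, Units.smul_def, mul_pow]

/-- The points of `P¹(L)` of minimal period `n ≠ 1` under Frobenius all lie in the affine line. -/
theorem card_minimalPeriod_frobP1 {L : Type*} [Field L] {q n : ℕ} (hq : q ≠ 0) (hn : n ≠ 1) :
    Nat.card {x : Projectivization L (Fin 2 → L) // minimalPeriod (frobP1 q) x = n} =
      {a : L | minimalPeriod (· ^ q) a = n}.ncard := by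
  classical
  let ι : L → Projectivization L (Fin 2 → L) := fun t => OnePoint.equivProjectivization L t
  have hι : Injective ι :=
    (OnePoint.equivProjectivization L).injective.comp OnePoint.coe_injective
  have hsemi : Semiconj ι (· ^ q) (frobP1 q) := fun t => by
    simp only [ι, OnePoint.equivProjectivization_apply_coe]
    rw [frobP1_mk_s14 _ _ _ (fun h => by simpa using congrFun h 1)]
    congr 1
    ext i
    fin_cases i <;> simp
  have hper (t : L) : minimalPeriod (frobP1 q) (ι t) = minimalPeriod (· ^ q) t := by
    rw [minimalPeriod_eq_minimalPeriod_iff]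
    intro k
    rw [IsPeriodicPt, IsFixedPt, ← (hsemi.iterate_right k).eq, hι.eq_iff]
    rfl
  have hinfty : minimalPeriod (frobP1 q)
      (OnePoint.equivProjectivization L OnePoint.infty) = 1 := by
    rw [minimalPeriod_eq_one_iff_isFixedPt, IsFixedPt,
      OnePoint.equivProjectivization_apply_infinity,
      frobP1_mk_s14 _ _ _ (fun h => by simpa using congrFun h 0)]
    congr 1
    ext i
    fin_cases i <;> simp [hq]
  rw [← Set.ncard_image_of_injective _ hι]
  refine congrArg Set.ncard (Set.Subset.antisymm (fun x hx => ?_) ?_)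
  · obtain ⟨t, rfl⟩ := (OnePoint.equivProjectivization L).surjective x
    change minimalPeriod (frobP1 q) _ = n at hx
    cases t with
    | infty => exact absurd (hx.symm.trans hinfty) hn
    | coe t => exact ⟨t, (hper t).symm.trans hx, rfl⟩
  · rintro _ ⟨t, ht, rfl⟩
    exact (hper t).trans ht

theorem minimalPeriod_eq_six_iff {α : Type*} (f : α → α) (a : α) :
    minimalPeriod f a = 6 ↔ IsPeriodicPt f 6 a ∧ ¬ (IsPeriodicPt f 3 a ∨ IsPeriodicPt f 2 a) := by
  simp only [isPeriodicPt_iff_minimalPeriod_dvd]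
  refine ⟨fun h => by simp [h], fun ⟨h6, h⟩ => ?_⟩
  have hle := Nat.le_of_dvd (by norm_num) h6
  interval_cases minimalPeriod f a <;> simp_all

/-- Inclusion-exclusion for the number of points of minimal period six. -/
theorem ncard_minimalPeriod_eq_six {α : Type*} (f : α → α) (h6 : (ptsOfPeriod f 6).Finite) :
    ({a | minimalPeriod f a = 6}.ncard : ℤ) = (ptsOfPeriod f 6).ncard - (ptsOfPeriod f 3).ncard -
      (ptsOfPeriod f 2).ncard + (ptsOfPeriod f 1).ncard := by
  have hset : {a | minimalPeriod f a = 6} =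
      ptsOfPeriod f 6 \ (ptsOfPeriod f 3 ∪ ptsOfPeriod f 2) :=
    Set.ext fun a => minimalPeriod_eq_six_iff f a
  have hsub3 : ptsOfPeriod f 3 ⊆ ptsOfPeriod f 6 :=
    fun a (ha : IsPeriodicPt f 3 a) => ha.trans_dvd (by norm_num)
  have hsub2 : ptsOfPeriod f 2 ⊆ ptsOfPeriod f 6 :=
    fun a (ha : IsPeriodicPt f 2 a) => ha.trans_dvd (by norm_num)
  have hinter : ptsOfPeriod f 3 ∩ ptsOfPeriod f 2 = ptsOfPeriod f 1 := by
    ext a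
    exact ⟨fun h => h.1.gcd h.2,
      fun (h : IsPeriodicPt f 1 a) => ⟨h.trans_dvd (one_dvd _), h.trans_dvd (one_dvd _)⟩⟩
  have hdiff := Set.ncard_sdiff_add_ncard_of_subset (Set.union_subset hsub3 hsub2) h6
  have hunion := Set.ncard_union_add_ncard_inter _ _ (h6.subset hsub3) (h6.subset hsub2)
  rw [hinter] at hunion
  rw [hset]
  lia

/-- In a separably closed field of characteristic dividing `q`, the map `a ↦ a ^ q` has `q ^ n`
points of period `n`. -/
theorem ncard_ptsOfPeriod_pow {L : Type*} [Field L] [IsSepClosed L] (p : ℕ) [CharP L p] {q n : ℕ}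
    (hp : p ∣ q) (hq : 1 < q) (hn : n ≠ 0) : (ptsOfPeriod (· ^ q : L → L) n).ncard = q ^ n := by
  classical
  have hne := FiniteField.X_pow_card_pow_sub_X_ne_zero L hn hq
  have hsep : (X ^ q ^ n - X : L[X]).Separable :=
    galois_poly_separable p _ (hp.trans (dvd_pow_self q hn))
  have hset : ptsOfPeriod (· ^ q : L → L) n = (X ^ q ^ n - X : L[X]).rootSet L := by
    ext a
    simp [mem_rootSet, hne, IsPeriodicPt, IsFixedPt, pow_iterate, sub_eq_zero]
  rw [hset, ← Nat.card_coe_set_eq, Nat.card_eq_fintype_card, card_rootSet_eq_natDegree hsep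
    (by simpa using IsSepClosed.splits_of_separable _ hsep),
    FiniteField.X_pow_card_pow_sub_X_natDegree_eq L hn hq]

/-- the number of injective 6-tuples of points of `P¹(K̄)`
satisfying the stated Frobenius conditions. -/
theorem statement14 (q : ℕ) (hq : IsPrimePow q)
    (K : Type*) [Field K] [Fintype K] (hK : Fintype.card K = q) :
    (Nat.card
      {x : Fin 6 → Projectivization (AlgebraicClosure K) (Fin 2 → AlgebraicClosure K) //
        Function.Injective x ∧
        frobP1 q (x 0) = x 1 ∧
        frobP1 q (x 1) = x 2 ∧
        frobP1 q (x 2) = x 3 ∧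
        frobP1 q (x 3) = x 4 ∧
        frobP1 q (x 4) = x 5 ∧
        frobP1 q (x 5) = x 0} : ℤ)
    = (q : ℤ) ^ 6 - (q : ℤ) ^ 3 - (q : ℤ) ^ 2 + (q : ℤ) := by
  obtain ⟨p, hp⟩ := CharP.exists K
  have hpq : p ∣ q := (CharP.cast_eq_zero_iff K p q).1 (hK ▸ Nat.cast_card_eq_zero K)
  have : CharP (AlgebraicClosure K) p := charP_of_injective_algebraMap' K p
  have hcard {n : ℕ} (hn : n ≠ 0) :=
    ncard_ptsOfPeriod_pow (L := AlgebraicClosure K) p hpq hq.one_lt hn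
  have htuples := Nat.card_congr (cyclicTuplesEquiv (frobP1 (L := AlgebraicClosure K) q) 6)
  simp only [Fin.forall_fin_succ, IsEmpty.forall_iff, and_true] at htuples
  have hfin : (ptsOfPeriod (· ^ q : AlgebraicClosure K → AlgebraicClosure K) 6).Finite :=
    Set.finite_of_ncard_pos (by rw [hcard (by norm_num)]; exact pow_pos hq.pos 6)
  refine (congrArg Nat.cast (htuples.trans
    (card_minimalPeriod_frobP1 (n := 6) hq.ne_zero (by norm_num)))).trans ?_
  rw [ncard_minimalPeriod_eq_six _ hfin]
  simp [hcard]
end
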